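/- arXiv:2007.13864 — 2 statements merged into one kernel-verified Lean document; each statement's English description precedes it below -/
import Mathlib

section
/- Let m ≥ 1, let h be a threshold function, and let χ and χ̃ be child distributions with finite m-th moments whose automaton distribution maps are Ψ and Ψ̃ respectively. If χ(ℓ) = χ̃(ℓ) for every ℓ with h(ℓ) ≤ m, then Ψ^{(m)}(0) = Ψ̃^{(m)}(0). -/
/-- `B≥_{n,k}(x) = Σ_{j=k}^{n} C(n,j)·x^j·(1−x)^{n−j}`. -/
noncomputable def Bge (n k : ℕ) (x : ℝ) : ℝ :=
  ∑ j ∈ Finset.Icc k n, (n.choose j : ℝ) * x ^ j * (1 - x) ^ (n - j)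

/-- A child distribution: nonnegative, summable, total mass one. -/
def IsChildDist (χ : ℕ → ℝ) : Prop :=
  (∀ n, 0 ≤ χ n) ∧ Summable χ ∧ (∑' n, χ n) = 1

/-- The automaton distribution map of a recursive tree system `(χ, h)`. -/
noncomputable def Psi (χ : ℕ → ℝ) (h : ℕ → ℕ) (x : ℝ) : ℝ :=
  ∑' n, χ n * Bge n (h n) x

open Filter Topology

/-- The Bernstein form of degree `n` with coefficients `c`, given by de Casteljau's recursion. -/
noncomputable def bernsteinForm : ℕ → (ℕ → ℝ) → ℝ → ℝ
  | 0, c, _ => c 0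
  | n + 1, c, x =>
    (1 - x) * bernsteinForm n c x + x * bernsteinForm n (fun j => c (j + 1)) x

theorem bernsteinForm_sub (n : ℕ) (c d : ℕ → ℝ) (x : ℝ) :
    bernsteinForm n (fun j => c j - d j) x = bernsteinForm n c x - bernsteinForm n d x := by
  induction n generalizing c d with
  | zero => rfl
  | succ n ih =>
    simp only [bernsteinForm, ih c d, ih (fun j => c (j + 1)) (fun j => d (j + 1))]
    ring

theorem bernsteinForm_zero_right (n : ℕ) (c : ℕ → ℝ) : bernsteinForm n c 0 = c 0 := by
  induction n generalizing c with
  | zero => rfl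
  | succ n ih => simp [bernsteinForm, ih]

theorem abs_bernsteinForm_le (n : ℕ) (c : ℕ → ℝ) {M x : ℝ} (hc : ∀ j, |c j| ≤ M)
    (hx : x ∈ Set.Icc (0 : ℝ) 1) : |bernsteinForm n c x| ≤ M := by
  induction n generalizing c with
  | zero => exact hc 0
  | succ n ih =>
    have h₁ := abs_le.1 (ih c hc)
    have h₂ := abs_le.1 (ih (fun j => c (j + 1)) fun j => hc (j + 1))
    obtain ⟨h0, h1⟩ := hx
    rw [bernsteinForm, abs_le]
    constructor <;> nlinarith

theorem bernsteinForm_eq_sum (n : ℕ) (c : ℕ → ℝ) (x : ℝ) :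
    bernsteinForm n c x =
      ∑ j ∈ Finset.range (n + 1), c j * ((n.choose j : ℝ) * x ^ j * (1 - x) ^ (n - j)) := by
  induction n generalizing c with
  | zero => simp [bernsteinForm]
  | succ n ih =>
    have hlow : (1 - x) * bernsteinForm n c x =
        ∑ j ∈ Finset.range (n + 2), c j * ((n.choose j : ℝ) * x ^ j * (1 - x) ^ (n + 1 - j)) := by
      rw [ih, Finset.sum_range_succ _ (n + 1), Finset.mul_sum]
      simp only [Nat.choose_succ_self, Nat.cast_zero, zero_mul, mul_zero, add_zero]
      refine Finset.sum_congr rfl fun j hj => ?_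
      rw [Nat.succ_sub (Nat.lt_succ_iff.1 (Finset.mem_range.1 hj)), pow_succ]
      ring
    rw [bernsteinForm, hlow, ih, Finset.sum_range_succ' _ (n + 1), Finset.sum_range_succ' _ (n + 1),
      Finset.mul_sum, add_right_comm, ← Finset.sum_add_distrib]
    congr 1
    · refine Finset.sum_congr rfl fun j _ => ?_
      rw [Nat.choose_succ_succ, Nat.add_sub_add_right, Nat.cast_add, pow_succ]
      ring
    · simp

theorem Bge_eq_bernsteinForm (n k : ℕ) (x : ℝ) :
    Bge n k x = bernsteinForm n (fun j => if k ≤ j then 1 else 0) x := by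
  simp only [bernsteinForm_eq_sum, Bge, ite_mul, one_mul, zero_mul, ← Finset.sum_filter]
  refine Finset.sum_congr ?_ fun _ _ => rfl
  ext j
  simp only [Finset.mem_Icc, Finset.mem_filter, Finset.mem_range]
  omega

theorem hasDerivAt_bernsteinForm (n : ℕ) (c : ℕ → ℝ) (x : ℝ) :
    HasDerivAt (bernsteinForm n c) (n * bernsteinForm (n - 1) (fwdDiff 1 c) x) x := by
  induction n generalizing c with
  | zero => simpa [bernsteinForm] using hasDerivAt_const x (c 0)
  | succ n ih =>
    have key := (((hasDerivAt_id x).const_sub 1).mul (ih c)).add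
      ((hasDerivAt_id x).mul (ih fun j => c (j + 1)))
    refine key.congr_deriv ?_
    have hsub : bernsteinForm n (fwdDiff 1 c) x =
        bernsteinForm n (fun j => c (j + 1)) x - bernsteinForm n c x :=
      bernsteinForm_sub n (fun j => c (j + 1)) c x
    cases n with
    | zero => simp [hsub]; ring
    | succ n =>
      have hrec : bernsteinForm (n + 1) (fwdDiff 1 c) x =
        (1 - x) * bernsteinForm n (fwdDiff 1 c) x +
          x * bernsteinForm n (fwdDiff 1 fun j => c (j + 1)) x := rfl
      simp only [id, Nat.add_sub_cancel, Nat.cast_add, Nat.cast_one]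
      linear_combination (-(n : ℝ) - 1) * hrec - hsub

theorem abs_fwdDiff_iter_le (r : ℕ) (c : ℕ → ℝ) (hc : ∀ j, |c j| ≤ 1) (j : ℕ) :
    |(fwdDiff 1)^[r] c j| ≤ 2 ^ r := by
  induction r generalizing j with
  | zero => simpa using hc j
  | succ r ih =>
    rw [Function.iterate_succ_apply', fwdDiff, pow_succ]
    have h₁ := abs_le.1 (ih j)
    have h₂ := abs_le.1 (ih (j + 1))
    rw [abs_le]
    constructor <;> linarith

theorem fwdDiff_iter_apply_zero_of_eq_zero (r : ℕ) (c : ℕ → ℝ) (hc : ∀ j ≤ r, c j = 0) :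
    (fwdDiff 1)^[r] c 0 = 0 := by
  rw [fwdDiff_iter_eq_sum_shift]
  refine Finset.sum_eq_zero fun j hj => ?_
  rw [hc _ (by simpa using Nat.lt_succ_iff.1 (Finset.mem_range.1 hj)), smul_zero]

/-- Termwise differentiation of a series on a convex set, with one-sided derivatives allowed. -/
theorem hasDerivWithinAt_tsum_of_convex {s : Set ℝ} (hs : Convex ℝ s) {f f' : ℕ → ℝ → ℝ}
    {u : ℕ → ℝ} (hu : Summable u)
    (hf : ∀ n, ∀ y ∈ s, HasDerivWithinAt (f n) (f' n y) s y)
    (hf' : ∀ n, ∀ y ∈ s, |f' n y| ≤ u n)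
    (hsum : ∀ y ∈ s, Summable fun n => f n y) {x : ℝ} (hx : x ∈ s) :
    HasDerivWithinAt (fun y => ∑' n, f n y) (∑' n, f' n x) s x := by
  rw [hasDerivWithinAt_iff_tendsto_slope]
  have hlim : Tendsto (fun y => ∑' n, slope (f n) x y) (𝓝[s \ {x}] x) (𝓝 (∑' n, f' n x)) := by
    refine tendsto_tsum_of_dominated_convergence hu
      (fun n => hasDerivWithinAt_iff_tendsto_slope.1 (hf n x hx)) ?_
    filter_upwards [self_mem_nhdsWithin] with y hy n
    have hmvt := hs.norm_image_sub_le_of_norm_hasDerivWithin_le (hf n) (hf' n) hx hy.1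
    have hpos : 0 < ‖y - x‖ := norm_pos_iff.2 (sub_ne_zero.2 hy.2)
    rw [slope_def_field, norm_div, div_le_iff₀ hpos]
    exact hmvt
  refine hlim.congr' ?_
  filter_upwards [self_mem_nhdsWithin] with y hy
  simp only [slope_def_field]
  rw [tsum_div_const, (hsum y hy.1).tsum_sub (hsum x hx)]

/-- The `r`-th derivative of `Bge n k`. -/
noncomputable def BgeDeriv (r n k : ℕ) (x : ℝ) : ℝ :=
  n.descFactorial r *
    bernsteinForm (n - r) ((fwdDiff 1)^[r] fun j => if k ≤ j then 1 else 0) x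

theorem hasDerivAt_BgeDeriv (r n k : ℕ) (x : ℝ) :
    HasDerivAt (BgeDeriv r n k) (BgeDeriv (r + 1) n k x) x := by
  refine ((hasDerivAt_bernsteinForm (n - r) _ x).const_mul (n.descFactorial r : ℝ)).congr_deriv ?_
  rw [BgeDeriv, Function.iterate_succ_apply', Nat.descFactorial_succ, Nat.sub_sub, Nat.cast_mul]
  ring

theorem abs_BgeDeriv_le (r n k : ℕ) {x : ℝ} (hx : x ∈ Set.Icc (0 : ℝ) 1) :
    |BgeDeriv r n k x| ≤ (n : ℝ) ^ r * 2 ^ r := by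
  rw [BgeDeriv, abs_mul, Nat.abs_cast]
  refine mul_le_mul (mod_cast Nat.descFactorial_le_pow n r)
    (abs_bernsteinForm_le _ _ (abs_fwdDiff_iter_le r _ fun j => ?_) hx) (abs_nonneg _)
    (by positivity)
  split_ifs <;> simp

theorem BgeDeriv_apply_zero_of_lt {r n k : ℕ} (hk : r < k) : BgeDeriv r n k 0 = 0 := by
  rw [BgeDeriv, bernsteinForm_zero_right, fwdDiff_iter_apply_zero_of_eq_zero, mul_zero]
  intro j hj
  exact if_neg (by omega)

theorem summable_moment_of_le {χ : ℕ → ℝ} (hχ : IsChildDist χ) {m r : ℕ} (hr : r ≤ m)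
    (hmom : Summable fun n => χ n * (n : ℝ) ^ m) :
    Summable fun n => χ n * ((n : ℝ) ^ r * 2 ^ r) := by
  have hbase : Summable fun n => χ n * (n : ℝ) ^ r := by
    refine (hχ.2.1.add hmom).of_nonneg_of_le
      (fun n => mul_nonneg (hχ.1 n) (by positivity)) fun n => ?_
    have hpow : (n : ℝ) ^ r ≤ 1 + (n : ℝ) ^ m := by
      rcases Nat.eq_zero_or_pos n with rfl | hn
      · have h₁ : ((0 : ℕ) : ℝ) ^ r ≤ 1 := pow_le_one₀ (by simp) (by simp)
        have h₂ : (0 : ℝ) ≤ ((0 : ℕ) : ℝ) ^ m := by positivity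
        linarith
      · have h₁ : (n : ℝ) ^ r ≤ (n : ℝ) ^ m := pow_le_pow_right₀ (mod_cast hn) hr
        linarith
    calc χ n * (n : ℝ) ^ r ≤ χ n * (1 + (n : ℝ) ^ m) :=
          mul_le_mul_of_nonneg_left hpow (hχ.1 n)
      _ = χ n + χ n * (n : ℝ) ^ m := by ring
  simpa only [mul_assoc] using hbase.mul_right (2 ^ r)

/-- The automaton distribution map may be differentiated termwise as often as it has moments. -/
theorem iteratedDerivWithin_Psi {χ : ℕ → ℝ} (hχ : IsChildDist χ) (h : ℕ → ℕ) {m r : ℕ}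
    (hr : r ≤ m) (hmom : Summable fun n => χ n * (n : ℝ) ^ m) {x : ℝ}
    (hx : x ∈ Set.Icc (0 : ℝ) 1) :
    iteratedDerivWithin r (Psi χ h) (Set.Icc (0 : ℝ) 1) x = ∑' n, χ n * BgeDeriv r n (h n) x := by
  induction r generalizing x with
  | zero =>
    simp [Psi, BgeDeriv, Bge_eq_bernsteinForm]
  | succ r ih =>
    have hbound : ∀ q n, ∀ y ∈ Set.Icc (0 : ℝ) 1,
        |χ n * BgeDeriv q n (h n) y| ≤ χ n * ((n : ℝ) ^ q * 2 ^ q) := fun q n y hy => by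
      rw [abs_mul, abs_of_nonneg (hχ.1 n)]
      exact mul_le_mul_of_nonneg_left (abs_BgeDeriv_le q n (h n) hy) (hχ.1 n)
    rw [iteratedDerivWithin_succ, derivWithin_congr (fun y hy => ih (by omega) hy)
      (ih (by omega) hx)]
    refine HasDerivWithinAt.derivWithin ?_ (uniqueDiffOn_Icc zero_lt_one x hx)
    exact hasDerivWithinAt_tsum_of_convex (convex_Icc 0 1) (summable_moment_of_le hχ hr hmom)
      (fun n y _ => ((hasDerivAt_BgeDeriv r n (h n) y).const_mul (χ n)).hasDerivWithinAt)
      (hbound (r + 1))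
      (fun y hy => (summable_moment_of_le hχ (by omega) hmom).of_norm_bounded
        fun n => hbound r n y hy) hx

theorem stmt5 (m : ℕ) (hm : 1 ≤ m) (h : ℕ → ℕ) (hh : ∀ n, 1 ≤ h n)
    (χ χ' : ℕ → ℝ) (hχ : IsChildDist χ) (hχ' : IsChildDist χ')
    (hmom : Summable fun n => χ n * (n : ℝ) ^ m)
    (hmom' : Summable fun n => χ' n * (n : ℝ) ^ m)
    (heq : ∀ n, h n ≤ m → χ n = χ' n) :
    iteratedDerivWithin m (Psi χ h) (Set.Icc (0 : ℝ) 1) 0 =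
      iteratedDerivWithin m (Psi χ' h) (Set.Icc (0 : ℝ) 1) 0 := by
  have h0 : (0 : ℝ) ∈ Set.Icc (0 : ℝ) 1 := ⟨le_rfl, zero_le_one⟩
  rw [iteratedDerivWithin_Psi hχ h le_rfl hmom h0, iteratedDerivWithin_Psi hχ' h le_rfl hmom' h0]
  refine tsum_congr fun n => ?_
  rcases le_or_gt (h n) m with hn | hn
  · rw [heq n hn]
  · rw [BgeDeriv_apply_zero_of_lt hn, mul_zero, mul_zero]
end

section
/- Let h be a threshold function that is (nonstrictly) increasing and satisfies h(ℓ) ≤ ℓ for all ℓ ≥ 1, and let χ be a child distribution with finite support such that (χ,h) is m-concordant with maximum threshold at most m. If χ is not the point mass δ_1 at 1, then tier_{χ,h}(k) is nonempty for every k ∈ {1,…,m} (so the maximum threshold is exactly m), and χ is a convex combination of measures crit(ℓ_1,…,ℓ_m) with each ℓ_k ∈ tier_{χ,h}(k): there exist nonnegative weights a_{(ℓ_1,…,ℓ_m)}, indexed by tuples with ℓ_k ∈ tier_{χ,h}(k), summing to 1, such that χ(ℓ) = Σ a_{(ℓ_1,…,ℓ_m)} · crit(ℓ_1,…,ℓ_m)(ℓ)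 for every ℓ, where crit(ℓ_1,…,ℓ_m) denotes the unique child distribution supported within {0, ℓ_1, …, ℓ_m} for which the system with threshold function h is m-concordant. -/
/-- `Ψ` is `m`-concordant: the first `m` derivatives of `Ψ` at `0` (within `[0,1]`)
match those of the identity, i.e. `Ψ'(0) = 1` and `Ψ^{(k)}(0) = 0` for `2 ≤ k ≤ m`.
(For `m = 0` the condition is vacuous.) -/
def Concordant (m : ℕ) (Ψ : ℝ → ℝ) : Prop :=
  (1 ≤ m → iteratedDerivWithin 1 Ψ (Set.Icc (0 : ℝ) 1) 0 = 1) ∧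
  ∀ k, 2 ≤ k → k ≤ m → iteratedDerivWithin k Ψ (Set.Icc (0 : ℝ) 1) 0 = 0

open Polynomial

/-- The derivative of `B≥_{n,h(n)}` up to its positive constant factor. -/
noncomputable def tierKernel (h : ℕ → ℕ) (n : ℕ) : ℝ[X] :=
  X ^ (h n - 1) * (1 - X) ^ (n - h n)

/-- The constant factor of the derivative of `B≥_{n,h(n)}`. -/
noncomputable def tierFactor (h : ℕ → ℕ) (n : ℕ) : ℝ :=
  n * (n - 1).choose (h n - 1)

theorem tierFactor_pos {h : ℕ → ℕ} (hle : ∀ n, 1 ≤ n → h n ≤ n) {n : ℕ} (hn : 1 ≤ n) :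
    0 < tierFactor h n := by
  have := hle n hn
  have h1 : 0 < (n - 1).choose (h n - 1) := Nat.choose_pos (by omega)
  unfold tierFactor
  positivity

theorem coeff_tierKernel_of_lt {h : ℕ → ℕ} {n j : ℕ} (hj : j < h n - 1) :
    (tierKernel h n).coeff j = 0 := by
  rw [tierKernel, coeff_X_pow_mul', if_neg (by omega)]

theorem coeff_tierKernel_self {h : ℕ → ℕ} {n : ℕ} :
    (tierKernel h n).coeff (h n - 1) = 1 := by
  rw [tierKernel, coeff_X_pow_mul', if_pos le_rfl, Nat.sub_self, coeff_zero_eq_eval_zero]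
  simp

/-- `B≥_{n,k}` as a polynomial. -/
noncomputable def bgePoly (n k : ℕ) : ℝ[X] :=
  ∑ j ∈ Finset.Icc k n, bernsteinPolynomial ℝ n j

theorem eval_bgePoly (n k : ℕ) (x : ℝ) : (bgePoly n k).eval x = Bge n k x := by
  simp [bgePoly, Bge, eval_finsetSum, bernsteinPolynomial]

theorem Bge_one {n k : ℕ} (hk : k ≤ n) : Bge n k 1 = 1 := by
  rw [← eval_bgePoly, bgePoly, eval_finsetSum]
  simp [bernsteinPolynomial.eval_at_1, hk]

theorem Bge_zero_right {n k : ℕ} (hk : 1 ≤ k) : Bge n k 0 = 0 := by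
  rw [← eval_bgePoly, bgePoly, eval_finsetSum]
  refine Finset.sum_eq_zero fun j hj => ?_
  rw [bernsteinPolynomial.eval_at_0, if_neg]
  have := (Finset.mem_Icc.mp hj).1
  omega

theorem derivative_bgePoly (n k : ℕ) :
    derivative (bgePoly n (k + 1)) = n * bernsteinPolynomial ℝ (n - 1) k := by
  rcases le_or_gt (k + 1) n with hk | hk
  · rw [bgePoly, derivative_sum]
    have h1 : Finset.Icc (k + 1) n = (Finset.Ico k n).map (addRightEmbedding 1) := by
      rw [Finset.map_add_right_Ico]; rfl
    rw [h1, Finset.sum_map]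
    simp only [addRightEmbedding_apply, bernsteinPolynomial.derivative_succ]
    rw [← Finset.mul_sum]
    have h2 := Finset.sum_Ico_sub (fun j => bernsteinPolynomial ℝ (n - 1) j) (by omega : k ≤ n)
    rw [bernsteinPolynomial.eq_zero_of_lt ℝ (by omega : n - 1 < n)] at h2
    rw [← neg_eq_iff_eq_neg.mpr (h2.trans (zero_sub _)), ← Finset.sum_neg_distrib]
    simp
  · rw [bgePoly, Finset.Icc_eq_empty (by omega)]
    rcases Nat.eq_zero_or_pos n with rfl | hn
    · simp
    · simp [bernsteinPolynomial.eq_zero_of_lt ℝ (by omega : n - 1 < k)]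

theorem derivative_bgePoly_threshold {h : ℕ → ℕ} (hh : ∀ n, 1 ≤ h n) (n : ℕ) :
    derivative (bgePoly n (h n)) = C (tierFactor h n) * tierKernel h n := by
  obtain ⟨k, hk⟩ := Nat.exists_eq_add_of_le' (hh n)
  rw [hk, derivative_bgePoly, tierFactor, tierKernel, bernsteinPolynomial, hk,
    Nat.add_sub_cancel, show n - 1 - k = n - (k + 1) by omega]
  simp only [map_mul, map_natCast]
  ring

/-- The automaton distribution map of a distribution supported in `{0, …, N}`, as a polynomial. -/
noncomputable def psiPoly (N : ℕ) (χ : ℕ → ℝ) (h : ℕ → ℕ) : ℝ[X] :=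
  ∑ n ∈ Finset.range (N + 1), C (χ n) * bgePoly n (h n)

theorem Psi_eq_eval {N : ℕ} {χ : ℕ → ℝ} (hN : ∀ n, N < n → χ n = 0) (h : ℕ → ℕ) :
    Psi χ h = fun x => (psiPoly N χ h).eval x := by
  funext x
  rw [Psi, tsum_eq_sum (s := Finset.range (N + 1)), psiPoly, eval_finsetSum]
  · simp [eval_bgePoly]
  · intro n hn
    rw [hN n (by simpa using hn), zero_mul]

theorem derivative_psiPoly {h : ℕ → ℕ} (hh : ∀ n, 1 ≤ h n) (N : ℕ) (χ : ℕ → ℝ) :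
    derivative (psiPoly N χ h) =
      ∑ n ∈ Finset.range (N + 1), C (χ n * tierFactor h n) * tierKernel h n := by
  rw [psiPoly, derivative_sum]
  refine Finset.sum_congr rfl fun n _ => ?_
  rw [derivative_C_mul, derivative_bgePoly_threshold hh, C_mul, mul_assoc]

theorem iteratedDeriv_polynomial_eval (p : ℝ[X]) (k : ℕ) :
    iteratedDeriv k (fun x => p.eval x) = fun x => (derivative^[k] p).eval x := by
  induction k generalizing p with
  | zero => simp
  | succ k ih =>
    rw [iteratedDeriv_succ', Function.iterate_succ_apply, ← ih]
    congr 1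
    funext x
    exact p.deriv

theorem iteratedDerivWithin_polynomial_zero (p : ℝ[X]) (k : ℕ) :
    iteratedDerivWithin (k + 1) (fun x => p.eval x) (Set.Icc (0 : ℝ) 1) 0 =
      k.factorial * (derivative p).coeff k := by
  rw [iteratedDerivWithin_eq_iteratedDeriv (uniqueDiffOn_Icc zero_lt_one)
    (by simpa [coe_aeval_eq_eval] using (p.contDiff_aeval (𝕜 := ℝ) (k + 1 : ℕ)).contDiffAt) (by simp), iteratedDeriv_polynomial_eval]
  simp only
  rw [← coeff_zero_eq_eval_zero, Function.iterate_succ_apply, coeff_iterate_derivative]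
  simp [Nat.descFactorial_self]

theorem concordant_iff {N m : ℕ} {χ : ℕ → ℝ} {h : ℕ → ℕ} (hh : ∀ n, 1 ≤ h n)
    (hN : ∀ n, N < n → χ n = 0) :
    Concordant m (Psi χ h) ↔ ∀ j < m, ∑ n ∈ Finset.range (N + 1),
      χ n * tierFactor h n * (tierKernel h n).coeff j = if j = 0 then 1 else 0 := by
  have hcoeff : ∀ j, ∑ n ∈ Finset.range (N + 1),
      χ n * tierFactor h n * (tierKernel h n).coeff j = (derivative (psiPoly N χ h)).coeff j := by
    intro j
    rw [derivative_psiPoly hh, finsetSum_coeff]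
    simp only [coeff_C_mul]
  simp only [hcoeff, Concordant, Psi_eq_eval hN]
  constructor
  · rintro ⟨h1, h2⟩ j hj
    rcases j with _ | j
    · simpa [iteratedDerivWithin_polynomial_zero _ 0] using h1 (by omega)
    · have := h2 (j + 1 + 1) (by omega) (by omega)
      rw [iteratedDerivWithin_polynomial_zero] at this
      simpa [Nat.factorial_ne_zero] using this
  · intro H
    refine ⟨fun hm => ?_, fun k hk hkm => ?_⟩
    · rw [iteratedDerivWithin_polynomial_zero _ 0, H 0 (by omega)]
      simp
    · obtain ⟨j, rfl⟩ := Nat.exists_eq_add_of_le' hk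
      rw [show j + 2 = j + 1 + 1 from rfl, iteratedDerivWithin_polynomial_zero,
        H (j + 1) (by omega)]
      simp

/-- The residual polynomial of a tuple `g 1 < g 2 < ⋯`, in the variable `x / (1 - x)`, left after
matching the first `k` Taylor coefficients of the constant function `1`. -/
noncomputable def resid (g : ℕ → ℕ) : ℕ → ℕ[X]
  | 0 => 1
  | k + 1 => (resid g k * (1 + X) ^ ((g (k + 1) - (k + 1)) - (g k - k))).divX * (1 + X)

theorem resid_congr {g g' : ℕ → ℕ} {k : ℕ} (hg : ∀ j ≤ k, g j = g' j) :
    resid g k = resid g' k := by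
  induction k with
  | zero => rfl
  | succ k ih =>
    rw [resid, resid, ih fun j hj => hg j (by omega), hg (k + 1) le_rfl, hg k (by omega)]

theorem coeff_one_le_resid_succ (g : ℕ → ℕ) (k : ℕ) :
    (resid g k).coeff 1 ≤ (resid g (k + 1)).coeff 0 ∧
      (resid g (k + 1)).coeff 0 ≤ (resid g (k + 1)).coeff 1 := by
  rw [resid]
  set e := (g (k + 1) - (k + 1)) - (g k - k)
  constructor
  · have h0 : ((1 + X : ℕ[X]) ^ e).coeff 0 = 1 := by simp [coeff_one_add_X_pow]
    rw [mul_coeff_zero, coeff_divX, mul_coeff_one, h0]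
    simp
  · rw [mul_add, mul_one, coeff_add, coeff_add, coeff_mul_X, mul_comm _ X, coeff_X_mul_zero]
    omega

theorem resid_coeff_pos {g : ℕ → ℕ} (g0 : g 0 = 0) (g1 : 1 < g 1) (k : ℕ) :
    0 < (resid g k).coeff 0 := by
  have key : ∀ k, 0 < (resid g (k + 1)).coeff 0 := by
    intro k
    induction k with
    | zero =>
      simp only [resid, g0, one_mul]
      rw [mul_coeff_zero, coeff_divX, coeff_one_add_X_pow]
      simp
      omega
    | succ k ih =>
      have h1 := (coeff_one_le_resid_succ g k).2
      have h2 := (coeff_one_le_resid_succ g (k + 1)).1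
      omega
  rcases k with _ | k
  · simp [resid]
  · exact key k

theorem resid_identity {K : Type*} [CommRing K] {x t : K} (hxt : (1 - x) * t = 1) {g : ℕ → ℕ}
    (g0 : g 0 = 0) {n : ℕ} (hg : ∀ j < n, g j < g (j + 1)) :
    ∑ k ∈ Finset.range n, ((resid g k).coeff 0 : K) * (x ^ k * (1 - x) ^ (g (k + 1) - (k + 1))) +
      x ^ n * (1 - x) ^ (g n - n) * eval₂ (Nat.castRingHom K) (x * t) (resid g n) = 1 := by
  induction n with
  | zero => simp [resid, g0]
  | succ n ih =>
    refine Eq.trans ?_ (ih fun j hj => hg j (by omega))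
    rw [Finset.sum_range_succ, add_assoc, add_right_inj]
    have hlt := hg n (by omega)
    obtain ⟨e, he⟩ : ∃ e, g (n + 1) - (n + 1) = (g n - n) + e :=
      Nat.exists_eq_add_of_le (by omega)
    rw [resid, he, Nat.add_sub_cancel_left]
    have ht : 1 + x * t = t := by linear_combination -hxt
    set P := resid g n * (1 + X) ^ e with hP
    set ev := eval₂RingHom (Nat.castRingHom K) (x * t) with hev
    simp only [← coe_eval₂RingHom, ← hev]
    have hX : ev X = x * t := by simp [hev]
    have h1 : ev P = ev (resid g n) * t ^ e := by
      rw [hP, map_mul, map_pow, map_add, map_one, hX, ht]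
    have h2 : ev P = ev P.divX * (x * t) + ((resid g n).coeff 0 : K) := by
      conv_lhs => rw [← divX_mul_X_add P]
      rw [map_add, map_mul, hX, hP, mul_coeff_zero, coeff_one_add_X_pow]
      simp
    have h3 : (1 - x) ^ e * t ^ e = 1 := by rw [← mul_pow, hxt, one_pow]
    rw [map_mul, map_add, map_one, hX, ht]
    have h4 := h1.symm.trans h2
    rw [pow_add]
    linear_combination (-(x ^ n * (1 - x) ^ (g n - n) * (1 - x) ^ e)) * h4 +
      x ^ n * (1 - x) ^ (g n - n) * ev (resid g n) * h3

/-- The tuple `g` picks an index of tier `k` for every `k ∈ {1, …, n}`. -/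
structure IsTierTuple (h : ℕ → ℕ) (n : ℕ) (g : ℕ → ℕ) : Prop where
  zero : g 0 = 0
  pos : ∀ k, 1 ≤ k → k ≤ n → 1 ≤ g k
  tier : ∀ k, 1 ≤ k → k ≤ n → h (g k) = k

theorem IsTierTuple.mono {h : ℕ → ℕ} {n n' : ℕ} {g : ℕ → ℕ} (hg : IsTierTuple h n g)
    (hn : n' ≤ n) : IsTierTuple h n' g :=
  ⟨hg.zero, fun k h1 h2 => hg.pos k h1 (h2.trans hn), fun k h1 h2 => hg.tier k h1 (h2.trans hn)⟩

theorem IsTierTuple.lt_succ {h : ℕ → ℕ} (hmono : Monotone h) {n : ℕ} {g : ℕ → ℕ}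
    (hg : IsTierTuple h n g) {j : ℕ} (hj : j < n) : g j < g (j + 1) := by
  have h1 := hg.pos (j + 1) (by omega) (by omega)
  have h2 := hg.tier (j + 1) (by omega) (by omega)
  rcases Nat.eq_zero_or_pos j with rfl | hj0
  · rw [hg.zero]
    exact h1
  · have h3 := hg.tier j hj0 (by omega)
    by_contra hlt
    have := hmono (not_lt.mp hlt)
    omega

theorem IsTierTuple.sum_coeff {h : ℕ → ℕ} (hmono : Monotone h) {n : ℕ} {g : ℕ → ℕ}
    (hg : IsTierTuple h n g) {i : ℕ} (hi : i ≤ n) :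
    ∑ k ∈ Finset.range n, ((resid g k).coeff 0 : ℝ) * (tierKernel h (g (k + 1))).coeff i +
      (if i = n then ((resid g n).coeff 0 : ℝ) else 0) = if i = 0 then 1 else 0 := by
  have hunit : (1 - PowerSeries.X : PowerSeries ℝ) * (1 - PowerSeries.X)⁻¹ = 1 :=
    PowerSeries.mul_inv_cancel _ (by simp)
  have key := congrArg (PowerSeries.coeff i)
    (resid_identity hunit hg.zero (fun j hj => hg.lt_succ hmono hj))
  rw [map_add, map_sum, PowerSeries.coeff_one] at key
  rw [← key]
  congr 1
  · refine Finset.sum_congr rfl fun k hk => ?_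
    have hk' := Finset.mem_range.mp hk
    rw [tierKernel, hg.tier (k + 1) (by omega) (by omega), Nat.add_sub_cancel,
      ← map_natCast (PowerSeries.C (R := ℝ)), PowerSeries.coeff_C_mul, ← coeff_coe (R := ℝ),
      coe_mul, coe_pow, coe_pow, coe_sub, coe_one, coe_X]
  · rw [mul_assoc, PowerSeries.coeff_X_pow_mul']
    rcases hi.lt_or_eq with hlt | rfl
    · rw [if_neg (by omega), if_neg (by omega)]
    · rw [if_pos rfl, if_pos le_rfl, Nat.sub_self, PowerSeries.coeff_zero_eq_constantCoeff]
      rw [map_mul, hom_eval₂]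
      simp [eval₂_at_zero]

theorem IsTierTuple.eval_sum_le_one {h : ℕ → ℕ} (hmono : Monotone h) {n : ℕ} {g : ℕ → ℕ}
    (hg : IsTierTuple h n g) {x : ℝ} (hx0 : 0 ≤ x) (hx1 : x < 1) :
    ∑ k ∈ Finset.range n, ((resid g k).coeff 0 : ℝ) * (tierKernel h (g (k + 1))).eval x ≤ 1 := by
  have h1x : 0 < 1 - x := by linarith
  have key := resid_identity (mul_inv_cancel₀ h1x.ne') hg.zero
    (fun j hj => hg.lt_succ hmono hj)
  have hnn : 0 ≤ x ^ n * (1 - x) ^ (g n - n) * eval₂ (Nat.castRingHom ℝ) (x * (1 - x)⁻¹) (resid g n) := by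
    rw [eval₂_eq_sum]
    refine mul_nonneg (by positivity) (Finset.sum_nonneg fun i _ => ?_)
    simp only [eq_natCast]
    positivity
  rw [← key]
  refine le_trans (le_of_eq ?_) (le_add_of_nonneg_right hnn)
  refine Finset.sum_congr rfl fun k hk => ?_
  have hk' := Finset.mem_range.mp hk
  rw [tierKernel, hg.tier (k + 1) (by omega) (by omega)]
  simp

/-- The tuples `g` with `g k ∈ T k` for `k ∈ {1, …, n}` and `g k = 0` for all other `k`. -/
noncomputable def tierTuples (T : ℕ → Finset ℕ) (n : ℕ) : Finset (ℕ → ℕ) :=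
  open scoped Classical in
  ((Finset.Icc 1 n).pi T).image fun p k => if hk : k ∈ Finset.Icc 1 n then p k hk else 0

theorem mem_tierTuples {T : ℕ → Finset ℕ} {n : ℕ} {g : ℕ → ℕ} :
    g ∈ tierTuples T n ↔
      (∀ k ∈ Finset.Icc 1 n, g k ∈ T k) ∧ ∀ k, k ∉ Finset.Icc 1 n → g k = 0 := by
  classical
  rw [tierTuples, Finset.mem_image]
  constructor
  · rintro ⟨p, hp, rfl⟩
    refine ⟨fun k hk => ?_, fun k hk => by simp only [dif_neg hk]⟩
    simp only [dif_pos hk]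
    exact Finset.mem_pi.mp hp k hk
  · rintro ⟨h1, h2⟩
    refine ⟨fun k _ => g k, Finset.mem_pi.mpr h1, ?_⟩
    funext k
    by_cases hk : k ∈ Finset.Icc 1 n
    · rw [dif_pos hk]
    · rw [dif_neg hk, h2 k hk]

theorem update_mem_tierTuples {T : ℕ → Finset ℕ} {n k l : ℕ} {g : ℕ → ℕ}
    (hg : g ∈ tierTuples T n) (hk : k ∈ Finset.Icc 1 n) (hl : l ∈ T k) :
    Function.update g k l ∈ tierTuples T n := by
  rw [mem_tierTuples] at hg ⊢
  refine ⟨fun j hj => ?_, fun j hj => ?_⟩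
  · rcases eq_or_ne j k with rfl | hjk
    · simpa using hl
    · simpa [hjk] using hg.1 j hj
  · have hjk : j ≠ k := fun hjk => hj (hjk ▸ hk)
    simpa [hjk] using hg.2 j hj

theorem tierTuples_nonempty {T : ℕ → Finset ℕ} {n : ℕ}
    (hne : ∀ k ∈ Finset.Icc 1 n, (T k).Nonempty) : (tierTuples T n).Nonempty := by
  choose! f hf using hne
  refine ⟨fun k => if k ∈ Finset.Icc 1 n then f k else 0, mem_tierTuples.mpr ⟨?_, ?_⟩⟩
  · intro k hk
    simp only [if_pos hk]
    exact hf k hk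
  · intro k hk
    simp only [if_neg hk]

/-- The product weight of a tuple. -/
noncomputable def tupleWeight (c : ℕ → ℝ) (n : ℕ) (g : ℕ → ℕ) : ℝ :=
  ∏ k ∈ Finset.Icc 1 n, c (g k)

theorem tupleWeight_pos {T : ℕ → Finset ℕ} {c : ℕ → ℝ} {n : ℕ} {g : ℕ → ℕ}
    (hc : ∀ k, ∀ l ∈ T k, 0 < c l) (hg : g ∈ tierTuples T n) : 0 < tupleWeight c n g :=
  Finset.prod_pos fun k hk => hc k _ ((mem_tierTuples.mp hg).1 k hk)

theorem tupleWeight_update (c : ℕ → ℝ) {n k : ℕ} (g : ℕ → ℕ) (hk : k ∈ Finset.Icc 1 n) (l : ℕ) :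
    tupleWeight c n (Function.update g k l) * c (g k) = tupleWeight c n g * c l := by
  rw [tupleWeight, tupleWeight, ← Finset.mul_prod_erase _ _ hk, ← Finset.mul_prod_erase _ _ hk,
    Finset.prod_congr rfl (g := fun j => c (g j))]
  · rw [Function.update_self]
    ring
  · intro j hj
    rw [Function.update_of_ne (Finset.ne_of_mem_erase hj)]

/-- Under the product weight the coordinate `g k` is independent of every function of `g` which
does not depend on it. -/
theorem sum_tupleWeight_mul {T : ℕ → Finset ℕ} (c : ℕ → ℝ) {n k : ℕ} (hk : k ∈ Finset.Icc 1 n)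
    (u : ℕ → ℝ) {F : (ℕ → ℕ) → ℝ} (hF : ∀ g l, F (Function.update g k l) = F g) :
    (∑ l ∈ T k, c l) * ∑ g ∈ tierTuples T n, tupleWeight c n g * (u (g k) * F g) =
      (∑ l ∈ T k, c l * u l) * ∑ g ∈ tierTuples T n, tupleWeight c n g * F g := by
  rw [mul_comm, mul_comm (∑ l ∈ T k, c l * u l), Finset.sum_mul_sum, Finset.sum_mul_sum,
    ← Finset.sum_product', ← Finset.sum_product']
  have hmaps : ∀ p ∈ tierTuples T n ×ˢ T k,
      (Function.update p.1 k p.2, p.1 k) ∈ tierTuples T n ×ˢ T k := by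
    rintro ⟨g, l⟩ hp
    obtain ⟨hg, hl⟩ := Finset.mem_product.mp hp
    exact Finset.mem_product.mpr
      ⟨update_mem_tierTuples hg hk hl, (mem_tierTuples.mp hg).1 k hk⟩
  refine Finset.sum_nbij' (fun p => (Function.update p.1 k p.2, p.1 k))
    (fun p => (Function.update p.1 k p.2, p.1 k)) hmaps hmaps ?_ ?_ ?_
  · rintro ⟨g, l⟩ _
    simp
  · rintro ⟨g, l⟩ _
    simp
  · rintro ⟨g, l⟩ _
    simp only [hF]
    linear_combination (-(u (g k) * F g)) * tupleWeight_update c g hk l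

section TierAverages

variable {h : ℕ → ℕ} {T : ℕ → Finset ℕ} {c : ℕ → ℝ} {m n : ℕ}

theorem isTierTuple_of_mem (hT : ∀ k, ∀ l ∈ T k, 1 ≤ l ∧ h l = k) {g : ℕ → ℕ}
    (hg : g ∈ tierTuples T n) : IsTierTuple h n g := by
  obtain ⟨h1, h2⟩ := mem_tierTuples.mp hg
  exact ⟨h2 0 (by simp), fun k hk hkn => (hT k _ (h1 k (Finset.mem_Icc.mpr ⟨hk, hkn⟩))).1,
    fun k hk hkn => (hT k _ (h1 k (Finset.mem_Icc.mpr ⟨hk, hkn⟩))).2⟩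

theorem sum_tupleWeight_mul_resid (hc : ∀ k, ∀ l ∈ T k, 0 < c l)
    (hne : ∀ k ∈ Finset.Icc 1 n, (T k).Nonempty) {k : ℕ} (hkn : k < n)
    (hk : (∑ l ∈ T (k + 1), c l) * ∑ g ∈ tierTuples T n, tupleWeight c n g =
      ∑ g ∈ tierTuples T n, tupleWeight c n g * ((resid g k).coeff 0 : ℝ)) (u : ℕ → ℝ) :
    ∑ g ∈ tierTuples T n, tupleWeight c n g * (u (g (k + 1)) * ((resid g k).coeff 0 : ℝ)) =
      (∑ l ∈ T (k + 1), c l * u l) * ∑ g ∈ tierTuples T n, tupleWeight c n g := by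
  have hmem : k + 1 ∈ Finset.Icc 1 n := Finset.mem_Icc.mpr ⟨by omega, by omega⟩
  have hpos : 0 < ∑ l ∈ T (k + 1), c l := Finset.sum_pos (hc _) (hne _ hmem)
  refine mul_left_cancel₀ hpos.ne' ?_
  rw [sum_tupleWeight_mul c hmem u, ← hk]
  · ring
  · intro g l
    rw [resid_congr fun j hj => Function.update_of_ne (by omega) _ _]

/-- The total weight of tier `k + 1` is the average of the weights of tier `k + 1` over the
critical systems. -/
theorem tier_sum_eq_average (hmono : Monotone h) (hT : ∀ k, ∀ l ∈ T k, 1 ≤ l ∧ h l = k)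
    (hc : ∀ k, ∀ l ∈ T k, 0 < c l)
    (hconc : ∀ i < m, ∑ k ∈ Finset.range (i + 1), ∑ l ∈ T (k + 1),
      c l * (tierKernel h l).coeff i = if i = 0 then 1 else 0)
    (hne : ∀ k ∈ Finset.Icc 1 n, (T k).Nonempty) {k : ℕ} (hkn : k ≤ n) (hkm : k < m) :
    (∑ l ∈ T (k + 1), c l) * ∑ g ∈ tierTuples T n, tupleWeight c n g =
      ∑ g ∈ tierTuples T n, tupleWeight c n g * ((resid g k).coeff 0 : ℝ) := by
  induction k using Nat.strong_induction_on with
  | _ k ih =>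
  have hlast : ∑ l ∈ T (k + 1), c l * (tierKernel h l).coeff k = ∑ l ∈ T (k + 1), c l := by
    refine Finset.sum_congr rfl fun l hl => ?_
    have := coeff_tierKernel_self (h := h) (n := l)
    rw [(hT _ l hl).2, Nat.add_sub_cancel] at this
    rw [this, mul_one]
  have h1 := hconc k hkm
  rw [Finset.sum_range_succ, hlast] at h1
  have h2 : ∑ g ∈ tierTuples T n, tupleWeight c n g * (∑ j ∈ Finset.range k,
      ((resid g j).coeff 0 : ℝ) * (tierKernel h (g (j + 1))).coeff k + ((resid g k).coeff 0 : ℝ)) =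
      ∑ g ∈ tierTuples T n, tupleWeight c n g * if k = 0 then 1 else 0 := by
    refine Finset.sum_congr rfl fun g hg => ?_
    have := ((isTierTuple_of_mem hT hg).mono hkn).sum_coeff hmono le_rfl
    rw [if_pos rfl] at this
    rw [this]
  have h3 : ∑ g ∈ tierTuples T n, tupleWeight c n g * ∑ j ∈ Finset.range k,
      ((resid g j).coeff 0 : ℝ) * (tierKernel h (g (j + 1))).coeff k =
      (∑ j ∈ Finset.range k, ∑ l ∈ T (j + 1), c l * (tierKernel h l).coeff k) *
        ∑ g ∈ tierTuples T n, tupleWeight c n g := by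
    simp only [Finset.mul_sum (Finset.range k)]
    rw [Finset.sum_comm, Finset.sum_mul]
    refine Finset.sum_congr rfl fun j hj => ?_
    have hjk := Finset.mem_range.mp hj
    rw [← sum_tupleWeight_mul_resid hc hne (by omega) (ih j hjk (by omega) (by omega))
      fun l => (tierKernel h l).coeff k]
    exact Finset.sum_congr rfl fun g _ => by ring
  simp only [mul_add, Finset.sum_add_distrib] at h2
  rw [h3, ← Finset.sum_mul] at h2
  linear_combination (∑ g ∈ tierTuples T n, tupleWeight c n g) * h1 - h2

end TierAverages

/-- The masses at positive integers of the critical distribution of a tuple. -/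
noncomputable def critBase (h : ℕ → ℕ) (m : ℕ) (g : ℕ → ℕ) (n : ℕ) : ℝ :=
  ∑ k ∈ Finset.range m, if g (k + 1) = n then ((resid g k).coeff 0 : ℝ) / tierFactor h n else 0

/-- The critical distribution of a tuple with entries at most `N`. -/
noncomputable def crit (h : ℕ → ℕ) (m N : ℕ) (g : ℕ → ℕ) (n : ℕ) : ℝ :=
  if n = 0 then 1 - ∑ i ∈ Finset.range (N + 1), critBase h m g i else critBase h m g n

section Crit

variable {h : ℕ → ℕ} {m N : ℕ} {g : ℕ → ℕ}

theorem critBase_nonneg (n : ℕ) : 0 ≤ critBase h m g n := by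
  refine Finset.sum_nonneg fun k _ => ?_
  unfold tierFactor
  split_ifs <;> positivity

theorem critBase_eq_zero {n : ℕ} (hn : ∀ k, 1 ≤ k → k ≤ m → g k ≠ n) : critBase h m g n = 0 :=
  Finset.sum_eq_zero fun k hk =>
    if_neg (hn (k + 1) (by omega) (by have := Finset.mem_range.mp hk; omega))

theorem critBase_zero (hg : IsTierTuple h m g) : critBase h m g 0 = 0 :=
  critBase_eq_zero fun k hk hkm => (Nat.one_le_iff_ne_zero.mp (hg.pos k hk hkm))

theorem sum_critBase_mul (hle : ∀ n, 1 ≤ n → h n ≤ n) (hg : IsTierTuple h m g)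
    (hN : ∀ k, 1 ≤ k → k ≤ m → g k ≤ N) (u : ℕ → ℝ) :
    ∑ n ∈ Finset.range (N + 1), critBase h m g n * tierFactor h n * u n =
      ∑ k ∈ Finset.range m, ((resid g k).coeff 0 : ℝ) * u (g (k + 1)) := by
  simp only [critBase, Finset.sum_mul]
  rw [Finset.sum_comm]
  refine Finset.sum_congr rfl fun k hk => ?_
  have hkm := Finset.mem_range.mp hk
  have hgN := hN (k + 1) (by omega) (by omega)
  rw [Finset.sum_eq_single (g (k + 1))]
  · rw [if_pos rfl, div_mul_cancel₀ _
      (tierFactor_pos hle (hg.pos (k + 1) (by omega) (by omega))).ne']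
  · intro n _ hn
    rw [if_neg hn.symm, zero_mul, zero_mul]
  · intro hn
    exact absurd (Finset.mem_range.mpr (by omega)) hn

theorem critBase_eq_zero_of_lt (hN : ∀ k, 1 ≤ k → k ≤ m → g k ≤ N) {n : ℕ} (hn : N < n) :
    critBase h m g n = 0 :=
  critBase_eq_zero fun k hk hkm => by have := hN k hk hkm; omega

theorem sum_critBase_le_one (hh : ∀ n, 1 ≤ h n) (hmono : Monotone h)
    (hle : ∀ n, 1 ≤ n → h n ≤ n) (hg : IsTierTuple h m g)
    (hN : ∀ k, 1 ≤ k → k ≤ m → g k ≤ N) :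
    ∑ n ∈ Finset.range (N + 1), critBase h m g n ≤ 1 := by
  set p := psiPoly N (critBase h m g) h with hp
  have hp1 : p.eval 1 = ∑ n ∈ Finset.range (N + 1), critBase h m g n := by
    rw [hp, psiPoly, eval_finsetSum]
    refine Finset.sum_congr rfl fun n _ => ?_
    rw [eval_mul, eval_C, eval_bgePoly]
    rcases Nat.eq_zero_or_pos n with rfl | hn
    · rw [critBase_zero hg, zero_mul]
    · rw [Bge_one (hle n hn), mul_one]
  have hp0 : p.eval 0 = 0 := by
    rw [hp, psiPoly, eval_finsetSum]
    refine Finset.sum_eq_zero fun n _ => ?_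
    rw [eval_mul, eval_bgePoly, Bge_zero_right (hh n), mul_zero]
  have key := (convex_Icc (0 : ℝ) 1).image_sub_le_mul_sub_of_deriv_le (f := fun x => p.eval x)
    (C := 1) p.continuous.continuousOn p.differentiable.differentiableOn ?_ 0 (by simp) 1 (by simp)
    zero_le_one
  · rw [← hp1]
    linarith
  · intro x hx
    rw [interior_Icc] at hx
    rw [Polynomial.deriv, hp, derivative_psiPoly hh, eval_finsetSum]
    simp only [eval_mul, eval_C]
    rw [sum_critBase_mul hle hg hN fun n => (tierKernel h n).eval x]
    exact hg.eval_sum_le_one hmono hx.1.le hx.2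

theorem crit_eq_zero_of_lt (hN : ∀ k, 1 ≤ k → k ≤ m → g k ≤ N) {n : ℕ} (hn : N < n) :
    crit h m N g n = 0 := by
  rw [crit, if_neg (by omega), critBase_eq_zero_of_lt hN hn]

theorem isChildDist_crit (hh : ∀ n, 1 ≤ h n) (hmono : Monotone h)
    (hle : ∀ n, 1 ≤ n → h n ≤ n) (hg : IsTierTuple h m g)
    (hN : ∀ k, 1 ≤ k → k ≤ m → g k ≤ N) : IsChildDist (crit h m N g) := by
  have hzero : ∀ n ∉ Finset.range (N + 1), crit h m N g n = 0 := fun n hn =>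
    crit_eq_zero_of_lt hN (by simpa using hn)
  refine ⟨fun n => ?_, summable_of_ne_finset_zero hzero, ?_⟩
  · rw [crit]
    split_ifs
    · linarith [sum_critBase_le_one hh hmono hle hg hN]
    · exact critBase_nonneg n
  · rw [tsum_eq_sum hzero, Finset.sum_range_succ']
    simp only [crit, Nat.add_eq_zero_iff, one_ne_zero, and_false, if_false, if_true]
    rw [Finset.sum_range_succ', critBase_zero hg]
    ring

theorem concordant_crit (hh : ∀ n, 1 ≤ h n) (hmono : Monotone h)
    (hle : ∀ n, 1 ≤ n → h n ≤ n) (hg : IsTierTuple h m g)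
    (hN : ∀ k, 1 ≤ k → k ≤ m → g k ≤ N) : Concordant m (Psi (crit h m N g) h) := by
  rw [concordant_iff hh fun n hn => crit_eq_zero_of_lt hN hn]
  intro j hj
  have hbase : ∀ n, crit h m N g n * tierFactor h n = critBase h m g n * tierFactor h n := by
    intro n
    rw [crit]
    split_ifs with hn
    · simp [hn, tierFactor]
    · rfl
  simp only [hbase]
  rw [sum_critBase_mul hle hg hN fun n => (tierKernel h n).coeff j, ← hg.sum_coeff hmono hj.le,
    if_neg hj.ne, add_zero]

end Crit

/-- The indices in `{1, …, N}` of threshold `k` charged by `χ`. -/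
noncomputable def tierSet (N : ℕ) (χ : ℕ → ℝ) (h : ℕ → ℕ) (k : ℕ) : Finset ℕ :=
  {n ∈ Finset.range (N + 1) | 1 ≤ n ∧ h n = k ∧ 0 < χ n}

theorem mem_tierSet {N : ℕ} {χ : ℕ → ℝ} {h : ℕ → ℕ} {k n : ℕ} :
    n ∈ tierSet N χ h k ↔ n ≤ N ∧ 1 ≤ n ∧ h n = k ∧ 0 < χ n := by
  simp [tierSet]

theorem sum_tierSet {N M : ℕ} {χ : ℕ → ℝ} {h : ℕ → ℕ} (hh : ∀ n, 1 ≤ h n) {f : ℕ → ℝ}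
    (hf : ∀ n, f n ≠ 0 → 1 ≤ n ∧ h n ≤ M ∧ 0 < χ n) :
    ∑ k ∈ Finset.range M, ∑ n ∈ tierSet N χ h (k + 1), f n =
      ∑ n ∈ Finset.range (N + 1), f n := by
  simp only [tierSet, Finset.sum_filter]
  rw [Finset.sum_comm]
  refine Finset.sum_congr rfl fun n _ => ?_
  by_cases hn : f n = 0
  · simp [hn]
  · obtain ⟨h1, h2, h3⟩ := hf n hn
    have h4 := hh n
    rw [Finset.sum_eq_single (h n - 1)]
    · rw [if_pos ⟨h1, by omega, h3⟩]
    · intro k _ hk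
      rw [if_neg]
      rintro ⟨_, hk', _⟩
      omega
    · intro hk
      exact absurd (Finset.mem_range.mpr (by omega)) hk

theorem stmt14 (m : ℕ) (hm : 1 ≤ m) (h : ℕ → ℕ) (hh : ∀ n, 1 ≤ h n)
    (hmono : Monotone h) (hle : ∀ n, 1 ≤ n → h n ≤ n)
    (χ : ℕ → ℝ) (hχ : IsChildDist χ)
    (hfin : ∃ N, ∀ n, N < n → χ n = 0)
    (hconc : Concordant m (Psi χ h))
    (hmax : ∀ n, 0 < χ n → h n ≤ m)
    (hne : χ ≠ fun n => if n = 1 then 1 else 0) :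
    (∀ k, 1 ≤ k → k ≤ m → ∃ n, 1 ≤ n ∧ h n = k ∧ 0 < χ n) ∧
    ∃ (A : Finset (ℕ → ℕ)) (a : (ℕ → ℕ) → ℝ) (κ : (ℕ → ℕ) → ℕ → ℝ),
      (∀ g ∈ A, 0 ≤ a g) ∧ (∑ g ∈ A, a g) = 1 ∧
      (∀ g ∈ A, ∀ k, 1 ≤ k → k ≤ m → 1 ≤ g k ∧ h (g k) = k ∧ 0 < χ (g k)) ∧
      (∀ g ∈ A, IsChildDist (κ g) ∧
        (∀ n, κ g n ≠ 0 → n = 0 ∨ ∃ k, 1 ≤ k ∧ k ≤ m ∧ g k = n) ∧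
        Concordant m (Psi (κ g) h)) ∧
      ∀ n, χ n = ∑ g ∈ A, a g * κ g n := by
  obtain ⟨N, hN⟩ := hfin
  obtain ⟨hχ0, -, hχ1⟩ := hχ
  have hsum : ∑ n ∈ Finset.range (N + 1), χ n = 1 := by
    rw [← hχ1, tsum_eq_sum]
    intro n hn
    exact hN n (by simpa using hn)
  set T := tierSet N χ h
  set c : ℕ → ℝ := fun n => χ n * tierFactor h n with hcdef
  have hT : ∀ k, ∀ l ∈ T k, 1 ≤ l ∧ h l = k := fun k l hl =>
    ⟨(mem_tierSet.mp hl).2.1, (mem_tierSet.mp hl).2.2.1⟩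
  have hc : ∀ k, ∀ l ∈ T k, 0 < c l := fun k l hl =>
    mul_pos (mem_tierSet.mp hl).2.2.2 (tierFactor_pos hle (hT k l hl).1)
  have hc0 : ∀ n, c n ≠ 0 → 1 ≤ n ∧ 0 < χ n := by
    intro n hn
    refine ⟨Nat.one_le_iff_ne_zero.mpr ?_, (hχ0 n).lt_of_ne' (left_ne_zero_of_mul hn)⟩
    rintro rfl
    exact hn (by simp [hcdef, tierFactor])
  have hconc' : ∀ i < m, ∑ k ∈ Finset.range (i + 1), ∑ l ∈ T (k + 1),
      c l * (tierKernel h l).coeff i = if i = 0 then 1 else 0 := by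
    intro i hi
    rw [← (concordant_iff hh hN).mp hconc i hi]
    refine sum_tierSet hh fun n hn => ?_
    obtain ⟨h1, h2⟩ := hc0 n (left_ne_zero_of_mul hn)
    refine ⟨h1, ?_, h2⟩
    by_contra hlt
    exact right_ne_zero_of_mul hn (coeff_tierKernel_of_lt (by omega))
  have hbig : ∃ l ∈ T 1, 1 < l := by
    by_contra! hsmall
    have hh1 : h 1 = 1 := le_antisymm (hle 1 le_rfl) (hh 1)
    have hc1 : c 1 = χ 1 := by simp [hcdef, tierFactor, hh1]
    have htotal : ∑ l ∈ T 1, c l = 1 := by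
      rw [← (hconc' 0 (by omega)).trans (if_pos rfl), Finset.sum_range_one]
      refine Finset.sum_congr rfl fun l hl => ?_
      have := coeff_tierKernel_self (h := h) (n := l)
      rw [(hT _ l hl).2] at this
      rw [this, mul_one]
    have hle1 : ∑ l ∈ T 1, c l ≤ χ 1 := by
      rw [← hc1, ← Finset.sum_singleton c 1]
      refine Finset.sum_le_sum_of_subset_of_nonneg ?_ fun l hl _ => ?_
      · intro l hl
        exact Finset.mem_singleton.mpr (le_antisymm (hsmall l hl) (hT 1 l hl).1)
      · rw [Finset.mem_singleton.mp hl, hc1]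
        exact hχ0 1
    have hN1 : 1 ≤ N := by
      by_contra hlt
      have := hN 1 (by omega)
      linarith
    have hpair : ∀ n, n ≠ 1 → χ n = 0 := by
      intro n hn
      by_cases hnN : N < n
      · exact hN n hnN
      have : ∑ i ∈ {1, n}, χ i ≤ ∑ i ∈ Finset.range (N + 1), χ i := by
        refine Finset.sum_le_sum_of_subset_of_nonneg ?_ fun i _ _ => hχ0 i
        intro i hi
        rw [Finset.mem_insert, Finset.mem_singleton] at hi
        rw [Finset.mem_range]
        omega
      rw [Finset.sum_pair hn.symm] at this
      linarith [hχ0 n]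
    have hone : χ 1 = 1 := by
      rw [← hsum, Finset.sum_eq_single 1 fun n _ hn => hpair n hn]
      intro hn
      exact absurd (Finset.mem_range.mpr (by omega)) hn
    refine hne (funext fun n => ?_)
    split_ifs with hn
    · rw [hn, hone]
    · exact hpair n hn
  have hnonempty : ∀ n ≤ m, ∀ k ∈ Finset.Icc 1 n, (T k).Nonempty := by
    intro n
    induction n with
    | zero => simp
    | succ n ih =>
      intro hn k hk
      have hprev := ih (by omega)
      rcases (Finset.mem_Icc.mp hk).2.lt_or_eq with hlt | rfl
      · exact hprev k (Finset.mem_Icc.mpr ⟨(Finset.mem_Icc.mp hk).1, by omega⟩)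
      have havg := tier_sum_eq_average hmono hT hc hconc' hprev le_rfl (by omega : n < m)
      have hpos : 0 < ∑ g ∈ tierTuples T n, tupleWeight c n g * ((resid g n).coeff 0 : ℝ) := by
        obtain ⟨g, hg, hgpos⟩ : ∃ g ∈ tierTuples T n, 0 < (resid g n).coeff 0 := by
          obtain ⟨g, hg⟩ := tierTuples_nonempty hprev
          rcases Nat.eq_zero_or_pos n with rfl | hn0
          · exact ⟨g, hg, by simp [resid]⟩
          · obtain ⟨l, hl, hl1⟩ := hbig
            have hg' := update_mem_tierTuples hg (Finset.mem_Icc.mpr ⟨le_rfl, hn0⟩) hl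
            exact ⟨_, hg', resid_coeff_pos (isTierTuple_of_mem hT hg').zero (by simpa using hl1) n⟩
        refine Finset.sum_pos' (fun g' hg' => ?_) ⟨g, hg, ?_⟩
        · exact mul_nonneg (tupleWeight_pos hc hg').le (Nat.cast_nonneg _)
        · exact mul_pos (tupleWeight_pos hc hg) (Nat.cast_pos.mpr hgpos)
      by_contra hempty
      rw [Finset.not_nonempty_iff_eq_empty.mp hempty, Finset.sum_empty, zero_mul] at havg
      exact hpos.ne havg
  have hTne := hnonempty m le_rfl
  refine ⟨fun k hk hkm => ?_, ?_⟩
  · obtain ⟨n, hn⟩ := hTne k (Finset.mem_Icc.mpr ⟨hk, hkm⟩)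
    exact ⟨n, (mem_tierSet.mp hn).2⟩
  set A := tierTuples T m
  set Z := ∑ g ∈ A, tupleWeight c m g with hZ
  have hZpos : 0 < Z :=
    Finset.sum_pos (fun g hg => tupleWeight_pos hc hg) (tierTuples_nonempty hTne)
  have htuple : ∀ g ∈ A, IsTierTuple h m g := fun g hg => isTierTuple_of_mem hT hg
  have hmem : ∀ g ∈ A, ∀ k, 1 ≤ k → k ≤ m → g k ∈ T k := fun g hg k hk hkm =>
    (mem_tierTuples.mp hg).1 k (Finset.mem_Icc.mpr ⟨hk, hkm⟩)
  have hgN : ∀ g ∈ A, ∀ k, 1 ≤ k → k ≤ m → g k ≤ N := fun g hg k hk hkm =>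
    (mem_tierSet.mp (hmem g hg k hk hkm)).1
  have hweights : ∑ g ∈ A, tupleWeight c m g / Z = 1 := by
    rw [← Finset.sum_div, ← hZ, div_self hZpos.ne']
  have hbase : ∀ n, 1 ≤ n → ∑ g ∈ A, tupleWeight c m g / Z * critBase h m g n = χ n := by
    intro n hn
    have hfac := tierFactor_pos hle hn
    have hterm : ∀ k ∈ Finset.range m, ∑ g ∈ A, tupleWeight c m g *
        ((if g (k + 1) = n then (tierFactor h n)⁻¹ else 0) * ((resid g k).coeff 0 : ℝ)) =
        (∑ l ∈ T (k + 1), c l * if l = n then (tierFactor h n)⁻¹ else 0) * Z := by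
      intro k hk
      have hkm := Finset.mem_range.mp hk
      exact sum_tupleWeight_mul_resid hc hTne hkm
        (tier_sum_eq_average hmono hT hc hconc' hTne hkm.le hkm)
        fun l => if l = n then (tierFactor h n)⁻¹ else 0
    have hall : ∑ k ∈ Finset.range m, ∑ l ∈ T (k + 1),
        (c l * if l = n then (tierFactor h n)⁻¹ else 0) = χ n := by
      rw [sum_tierSet hh fun l hl => ?_]
      · rw [Finset.sum_eq_single n]
        · rw [if_pos rfl, hcdef]
          field_simp
        · intro l _ hl
          rw [if_neg hl, mul_zero]
        · intro hnN
          simp [hcdef, hN n (by simpa using hnN)]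
      · obtain ⟨h1, h2⟩ := hc0 l (left_ne_zero_of_mul hl)
        exact ⟨h1, hmax l h2, h2⟩
    have hdiv : ∑ g ∈ A, tupleWeight c m g * critBase h m g n = χ n * Z := by
      rw [← hall, Finset.sum_mul, ← Finset.sum_congr rfl hterm, Finset.sum_comm]
      refine Finset.sum_congr rfl fun g _ => ?_
      rw [critBase, Finset.mul_sum]
      refine Finset.sum_congr rfl fun k _ => ?_
      split_ifs
      · ring
      · ring
    rw [← mul_div_cancel_right₀ (χ n) hZpos.ne', ← hdiv, Finset.sum_div]
    exact Finset.sum_congr rfl fun g _ => by ring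
  refine ⟨A, fun g => tupleWeight c m g / Z, crit h m N, ?_, hweights, ?_, ?_, ?_⟩
  · intro g hg
    exact (div_pos (tupleWeight_pos hc hg) hZpos).le
  · intro g hg k hk hkm
    exact (mem_tierSet.mp (hmem g hg k hk hkm)).2
  · intro g hg
    refine ⟨isChildDist_crit hh hmono hle (htuple g hg) (hgN g hg), fun n hn => ?_,
      concordant_crit hh hmono hle (htuple g hg) (hgN g hg)⟩
    by_contra! hcon
    refine hn ?_
    rw [crit, if_neg hcon.1, critBase_eq_zero hcon.2]
  · intro n
    rcases Nat.eq_zero_or_pos n with rfl | hn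
    · simp only [crit, if_true, mul_sub, mul_one, Finset.sum_sub_distrib, hweights,
        Finset.mul_sum]
      have hbase0 : ∑ g ∈ A, tupleWeight c m g / Z * critBase h m g 0 = 0 :=
        Finset.sum_eq_zero fun g hg => by rw [critBase_zero (htuple g hg), mul_zero]
      rw [Finset.sum_comm, Finset.sum_range_succ',
        Finset.sum_congr rfl fun i _ => hbase (i + 1) (by omega), hbase0]
      rw [Finset.sum_range_succ'] at hsum
      linarith
    · rw [← hbase n hn]
      exact Finset.sum_congr rfl fun g _ => by rw [crit, if_neg (by omega)]
end
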